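/- Let (R, C) be the 2n×2n independent-set game with parameters γ and k, where 0 ≤ γ ≤ 1/4 and k > 0, and let μ = (1/T) ∑_{t=1}^T x^{(t)} ⊗ y^{(t)} be a uniform T-sparse ε-CE of (R, C) with ε ≤ 1/k², supported only on [n]×[n]. Then for every i ∈ [n] and every t ∈ [T], x_i^{(t)} · y_i^{(t)} ≤ 4T/k². -/

import Mathlib

open Finset Matrix

noncomputable section

/-- The probability simplex Δⁿ on `Fin n`. -/
def simplex (n : ℕ) : Set (Fin n → ℝ) :=
  {x | (∀ i, 0 ≤ x i) ∧ ∑ i, x i = 1}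

/-- The linear action of a deviation `φ : [n] → [n]` on vectors:
`(φ(x))_{i'} = ∑_{i : φ(i) = i'} x_i`. -/
def devApply {n : ℕ} (φ : Fin n → Fin n) (x : Fin n → ℝ) : Fin n → ℝ :=
  fun i' => ∑ i, if φ i = i' then x i else 0

/-- The deviation set Φ: either `φ(i) = i'` for all `i ≤ i₀` and `φ(i) = i` for `i > i₀`,
or `φ` is an internal deviation (identity on all but at most one point). -/
def InPhi {n : ℕ} (φ : Fin n → Fin n) : Prop :=
  (∃ i' i₀ : Fin n, ∀ i, (i ≤ i₀ → φ i = i') ∧ (i₀ < i → φ i = i)) ∨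
  (∃ i₀ : Fin n, ∀ i, i ≠ i₀ → φ i = i)

/-- `μ = (1/T) ∑_t x^{(t)} ⊗ y^{(t)}` is a uniform `T`-sparse `ε`-CE of `(R, C)`. -/
def IsSparseCE {n : ℕ} (R C : Matrix (Fin n) (Fin n) ℝ) (T : ℕ)
    (x y : Fin T → Fin n → ℝ) (ε : ℝ) : Prop :=
  ∀ φx φy : Fin n → Fin n, InPhi φx → InPhi φy →
    (1 / (T : ℝ)) * ∑ t, x t ⬝ᵥ R.mulVec (y t) ≥
      (1 / (T : ℝ)) * ∑ t, devApply φx (x t) ⬝ᵥ R.mulVec (y t) - ε ∧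
    (1 / (T : ℝ)) * ∑ t, x t ⬝ᵥ C.mulVec (y t) ≥
      (1 / (T : ℝ)) * ∑ t, x t ⬝ᵥ C.mulVec (devApply φy (y t)) - ε

/-- `μ = (1/T) ∑_t x^{(t)} ⊗ y^{(t)}` is a uniform `T`-sparse `ε`-CCE of `(R, C)`. -/
def IsSparseCCE {n : ℕ} (R C : Matrix (Fin n) (Fin n) ℝ) (T : ℕ)
    (x y : Fin T → Fin n → ℝ) (ε : ℝ) : Prop :=
  (∀ x' ∈ simplex n,
    (1 / (T : ℝ)) * ∑ t, x t ⬝ᵥ R.mulVec (y t) ≥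
      (1 / (T : ℝ)) * ∑ t, x' ⬝ᵥ R.mulVec (y t) - ε) ∧
  (∀ y' ∈ simplex n,
    (1 / (T : ℝ)) * ∑ t, x t ⬝ᵥ C.mulVec (y t) ≥
      (1 / (T : ℝ)) * ∑ t, x t ⬝ᵥ C.mulVec y' - ε)

/-- `(x, y)` is an `ε`-Nash equilibrium of `(R, C)`. -/
def IsNash {n : ℕ} (R C : Matrix (Fin n) (Fin n) ℝ) (x y : Fin n → ℝ) (ε : ℝ) : Prop :=
  (∀ x' ∈ simplex n, x ⬝ᵥ R.mulVec y ≥ x' ⬝ᵥ R.mulVec y - ε) ∧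
  (∀ y' ∈ simplex n, x ⬝ᵥ C.mulVec y ≥ x ⬝ᵥ C.mulVec y' - ε)

/-- The uniform distribution `u(S)` over a subset `S ⊆ [n]`. -/
def unif {n : ℕ} (S : Finset (Fin n)) : Fin n → ℝ :=
  fun i => if i ∈ S then (S.card : ℝ)⁻¹ else 0

/-- Embedding of the first `n` actions into `[2n]`. -/
def finL {n : ℕ} (i : Fin n) : Fin (2 * n) := ⟨(i : ℕ), by have := i.isLt; omega⟩

/-- Embedding of the last `n` actions into `[2n]`. -/
def finR {n : ℕ} (i : Fin n) : Fin (2 * n) := ⟨n + (i : ℕ), by have := i.isLt; omega⟩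

/-- `S` is an independent set of the graph with adjacency matrix `A`. -/
def IsIndepSet {n : ℕ} (A : Matrix (Fin n) (Fin n) ℝ) (S : Finset (Fin n)) : Prop :=
  ∀ i ∈ S, ∀ j ∈ S, i ≠ j → A i j = 0

/-- Row player's payoff matrix of the `2n × 2n` independent-set game:
`R = (1/2)·[[1 − A + (γ+1)I, −k·I], [k·I, 0]]`. -/
def ISR (n : ℕ) (A : Matrix (Fin n) (Fin n) ℝ) (γ k : ℝ) :
    Matrix (Fin (2 * n)) (Fin (2 * n)) ℝ := fun i j =>
  if hi : (i : ℕ) < n then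
    if hj : (j : ℕ) < n then
      (1 / 2) * ((1 - A ⟨(i : ℕ), hi⟩ ⟨(j : ℕ), hj⟩) +
        (γ + 1) * (if (i : ℕ) = (j : ℕ) then 1 else 0))
    else (1 / 2) * (-k) * (if (i : ℕ) + n = (j : ℕ) then 1 else 0)
  else
    if _hj : (j : ℕ) < n then
      (1 / 2) * k * (if (i : ℕ) = (j : ℕ) + n then 1 else 0)
    else 0

/-- Column player's payoff matrix of the `2n × 2n` independent-set game:
`C = (1/2)·[[1 − A + (γ+1)I, k·I], [−k·I, 0]]`. -/
def ISC (n : ℕ) (A : Matrix (Fin n) (Fin n) ℝ) (γ k : ℝ) :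
    Matrix (Fin (2 * n)) (Fin (2 * n)) ℝ := fun i j =>
  if hi : (i : ℕ) < n then
    if hj : (j : ℕ) < n then
      (1 / 2) * ((1 - A ⟨(i : ℕ), hi⟩ ⟨(j : ℕ), hj⟩) +
        (γ + 1) * (if (i : ℕ) = (j : ℕ) then 1 else 0))
    else (1 / 2) * k * (if (i : ℕ) + n = (j : ℕ) then 1 else 0)
  else
    if _hj : (j : ℕ) < n then
      (1 / 2) * (-k) * (if (i : ℕ) = (j : ℕ) + n then 1 else 0)
    else 0

theorem dev_dot {n : ℕ} (φ : Fin n → Fin n) (x v : Fin n → ℝ) :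
    devApply φ x ⬝ᵥ v = ∑ i, x i * v (φ i) := by
  simp only [devApply, dotProduct, Finset.sum_mul]
  rw [Finset.sum_comm]
  refine Finset.sum_congr rfl fun i _ => ?_
  simp [ite_mul]

theorem ISC_eq (n : ℕ) (A : Matrix (Fin n) (Fin n) ℝ)
    (hAsym : ∀ i j, A i j = A j i) (γ k : ℝ) : ISC n A γ k = (ISR n A γ k)ᵀ := by
  ext i j
  simp only [ISC, ISR, Matrix.transpose_apply]
  split_ifs <;> first | rfl | omega | (rw [hAsym])

theorem R_low {n : ℕ} (A : Matrix (Fin n) (Fin n) ℝ)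
    (hA01 : ∀ i j, A i j = 0 ∨ A i j = 1) (hAdiag : ∀ i, A i i = 1)
    (γ k : ℝ) (hγ : γ ≤ 1 / 4) (y : Fin (2 * n) → ℝ) (hy : y ∈ simplex (2 * n))
    (hs : ∀ i : Fin (2 * n), n ≤ (i : ℕ) → y i = 0) (i : Fin (2 * n)) (hi : (i : ℕ) < n) :
    (ISR n A γ k).mulVec y i ≤ 5 / 8 := by
  have h1 : ∀ j, ISR n A γ k i j * y j ≤ 5 / 8 * y j := by
    intro j
    by_cases hj : (j : ℕ) < n
    · refine mul_le_mul_of_nonneg_right ?_ (hy.1 j)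
      simp only [ISR, hi, hj, dif_pos]
      by_cases hij : (i : ℕ) = (j : ℕ)
      · have : (⟨(i : ℕ), hi⟩ : Fin n) = ⟨(j : ℕ), hj⟩ := by ext; exact hij
        rw [this, hAdiag, if_pos hij]; linarith
      · rw [if_neg hij]
        rcases hA01 ⟨(i : ℕ), hi⟩ ⟨(j : ℕ), hj⟩ with h | h <;> rw [h] <;> norm_num
    · rw [hs j (by omega)]; simp
  calc (ISR n A γ k).mulVec y i = ∑ j, ISR n A γ k i j * y j := rfl
    _ ≤ ∑ j, 5 / 8 * y j := Finset.sum_le_sum fun j _ => h1 j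
    _ = 5 / 8 := by rw [← Finset.mul_sum, hy.2, mul_one]

theorem R_high {n : ℕ} (A : Matrix (Fin n) (Fin n) ℝ) (γ k : ℝ) (y : Fin (2 * n) → ℝ)
    (i i' : Fin (2 * n)) (hi : (i : ℕ) < n) (hi' : (i' : ℕ) = i + n) :
    (ISR n A γ k).mulVec y i' = k / 2 * y i := by
  have h1 : ∀ j, ISR n A γ k i' j = if j = i then k / 2 else 0 := by
    intro j
    simp only [ISR, Fin.ext_iff]
    split_ifs <;> first | omega | ring
  change ∑ j, ISR n A γ k i' j * y j = _
  simp [h1]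

theorem row_bounds {n T : ℕ} (hT : 0 < T) (A : Matrix (Fin n) (Fin n) ℝ)
    (hA01 : ∀ i j, A i j = 0 ∨ A i j = 1) (hAdiag : ∀ i, A i i = 1)
    (γ k ε : ℝ) (hγ : γ ≤ 1 / 4)
    (x y : Fin T → Fin (2 * n) → ℝ)
    (hx : ∀ t, x t ∈ simplex (2 * n)) (hy : ∀ t, y t ∈ simplex (2 * n))
    (hxs : ∀ t (i : Fin (2 * n)), n ≤ (i : ℕ) → x t i = 0)
    (hys : ∀ t (i : Fin (2 * n)), n ≤ (i : ℕ) → y t i = 0)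
    (h : ∀ φ : Fin (2 * n) → Fin (2 * n), InPhi φ →
      (1 / (T : ℝ)) * ∑ t, x t ⬝ᵥ (ISR n A γ k).mulVec (y t) ≥
      (1 / (T : ℝ)) * ∑ t, devApply φ (x t) ⬝ᵥ (ISR n A γ k).mulVec (y t) - ε)
    (i : Fin (2 * n)) (hi : (i : ℕ) < n) :
    k / 2 * ∑ t, y t i ≤ T * (ε + 5 / 8) ∧
    k / 2 * ∑ t, x t i * y t i ≤ T * ε + 5 / 8 * ∑ t, x t i := by
  have hT' : (0 : ℝ) < T := by exact_mod_cast hT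
  have h' : ∀ φ : Fin (2 * n) → Fin (2 * n), InPhi φ →
      ∑ t, devApply φ (x t) ⬝ᵥ (ISR n A γ k).mulVec (y t)
        ≤ ∑ t, x t ⬝ᵥ (ISR n A γ k).mulVec (y t) + T * ε := by
    intro φ hφ
    have := mul_le_mul_of_nonneg_left (h φ hφ) hT'.le
    have e : ∀ a : ℝ, (T : ℝ) * (1 / T * a) = a := fun a => by field_simp
    rw [mul_sub, e, e] at this
    linarith
  obtain ⟨i', hi'⟩ : ∃ i' : Fin (2 * n), (i' : ℕ) = i + n := ⟨⟨i + n, by omega⟩, rfl⟩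
  constructor
  · have hc := h' (fun _ => i') (Or.inl ⟨i', ⟨2 * n - 1, by omega⟩, fun j =>
      ⟨fun _ => rfl, fun hj => by
        have := j.isLt
        have hj' : 2 * n - 1 < (j : ℕ) := hj
        omega⟩⟩)
    have e1 : ∀ t, devApply (fun _ => i') (x t) ⬝ᵥ (ISR n A γ k).mulVec (y t)
        = k / 2 * y t i := by
      intro t
      rw [dev_dot, ← Finset.sum_mul, (hx t).2, one_mul, R_high A γ k (y t) i i' hi hi']
    have e2 : ∑ t, x t ⬝ᵥ (ISR n A γ k).mulVec (y t) ≤ ∑ _t : Fin T, (5 / 8 : ℝ) := by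
      refine Finset.sum_le_sum fun t _ => ?_
      calc x t ⬝ᵥ (ISR n A γ k).mulVec (y t) ≤ ∑ j, x t j * (5 / 8) := by
            refine Finset.sum_le_sum fun j _ => ?_
            by_cases hj : (j : ℕ) < n
            · exact mul_le_mul_of_nonneg_left
                (R_low A hA01 hAdiag γ k hγ (y t) (hy t) (hys t) j hj) ((hx t).1 j)
            · rw [hxs t j (by omega)]; simp
        _ = 5 / 8 := by rw [← Finset.sum_mul, (hx t).2, one_mul]
    simp only [e1, ← Finset.mul_sum] at hc
    simp only [Finset.sum_const, Finset.card_univ, Fintype.card_fin, nsmul_eq_mul] at e2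
    linarith
  · have hc := h' (Function.update id i i') (Or.inr ⟨i, fun j hj => by simp [hj]⟩)
    have e1 : ∀ t, devApply (Function.update id i i') (x t) ⬝ᵥ (ISR n A γ k).mulVec (y t)
        - x t ⬝ᵥ (ISR n A γ k).mulVec (y t)
        = x t i * (k / 2 * y t i - (ISR n A γ k).mulVec (y t) i) := by
      intro t
      rw [dev_dot, dotProduct, ← Finset.sum_sub_distrib, Finset.sum_eq_single i]
      · rw [Function.update_self, R_high A γ k (y t) i i' hi hi']; ring
      · intro j _ hj
        simp [hj]
      · simp
    have e2 : ∀ t, k / 2 * (x t i * y t i) - 5 / 8 * x t i ≤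
        devApply (Function.update id i i') (x t) ⬝ᵥ (ISR n A γ k).mulVec (y t)
        - x t ⬝ᵥ (ISR n A γ k).mulVec (y t) := by
      intro t
      rw [e1]
      have := mul_le_mul_of_nonneg_left
        (R_low A hA01 hAdiag γ k hγ (y t) (hy t) (hys t) i hi) ((hx t).1 i)
      linarith
    have e3 := Finset.sum_le_sum (s := Finset.univ) fun t _ => e2 t
    rw [Finset.sum_sub_distrib, Finset.sum_sub_distrib, ← Finset.mul_sum, ← Finset.mul_sum] at e3
    linarith

/-- in an `ε`-CE (`ε ≤ 1/k²`) of the independent-set game (with `0 ≤ γ ≤ 1/4`)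
supported only on `[n] × [n]`, it holds that `x_i^{(t)} · y_i^{(t)} ≤ 4T/k²` for all `i, t`. -/
theorem CE_product_bound {n T : ℕ} (hT : 0 < T)
    (A : Matrix (Fin n) (Fin n) ℝ)
    (hA01 : ∀ i j, A i j = 0 ∨ A i j = 1)
    (hAsym : ∀ i j, A i j = A j i)
    (hAdiag : ∀ i, A i i = 1)
    (γ k ε : ℝ) (hγ0 : 0 ≤ γ) (hγ : γ ≤ 1 / 4) (hk : 0 < k) (hε : ε ≤ 1 / k ^ 2)
    (x y : Fin T → Fin (2 * n) → ℝ)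
    (hx : ∀ t, x t ∈ simplex (2 * n)) (hy : ∀ t, y t ∈ simplex (2 * n))
    (hCE : IsSparseCE (ISR n A γ k) (ISC n A γ k) T x y ε)
    (hsupp : ∀ t (i : Fin (2 * n)), n ≤ (i : ℕ) → x t i = 0 ∧ y t i = 0) :
    ∀ t (i : Fin (2 * n)), (i : ℕ) < n → x t i * y t i ≤ 4 * (T : ℝ) / k ^ 2 := by
  intro t i hi
  have hT' : (1 : ℝ) ≤ T := by exact_mod_cast hT
  have hxt := hx t
  have hyt := hy t
  have hle1 : ∀ (z : Fin (2 * n) → ℝ), z ∈ simplex (2 * n) → z i ≤ 1 := fun z hz => by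
    rw [← hz.2]; exact Finset.single_le_sum (fun j _ => hz.1 j) (Finset.mem_univ i)
  have hk2 : 0 < k ^ 2 := by positivity
  by_cases hbig : k ^ 2 ≤ 4 * T
  · have : 1 ≤ 4 * (T : ℝ) / k ^ 2 := by rwa [le_div_iff₀ hk2, one_mul]
    have := mul_le_one₀ (hle1 _ hxt) (hyt.1 i) (hle1 _ hyt)
    linarith
  push Not at hbig
  have hk' : 2 < k := by nlinarith
  have hid : InPhi (id : Fin (2 * n) → Fin (2 * n)) := Or.inr ⟨i, fun _ _ => rfl⟩
  have hr := row_bounds hT A hA01 hAdiag γ k ε hγ x y hx hy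
    (fun t i h => (hsupp t i h).1) (fun t i h => (hsupp t i h).2)
    (fun φ hφ => (hCE φ id hφ hid).1) i hi
  have hc := row_bounds hT A hA01 hAdiag γ k ε hγ y x hy hx
    (fun t i h => (hsupp t i h).2) (fun t i h => (hsupp t i h).1)
    (fun φ hφ => by
      have := (hCE id φ hid hφ).2
      rw [ISC_eq n A hAsym] at this
      have e : ∀ (u v : Fin (2 * n) → ℝ),
          u ⬝ᵥ (ISR n A γ k)ᵀ.mulVec v = v ⬝ᵥ (ISR n A γ k).mulVec u := fun u v => by
        rw [Matrix.mulVec_transpose, dotProduct_comm, Matrix.dotProduct_mulVec]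
      simpa only [e] using this) i hi
  have hsingle : x t i * y t i ≤ ∑ t, x t i * y t i :=
    Finset.single_le_sum (f := fun t => x t i * y t i)
      (fun s _ => mul_nonneg ((hx s).1 i) ((hy s).1 i)) (Finset.mem_univ t)
  have h1 := hr.2
  have h2 := hc.1
  generalize ∑ t, x t i * y t i = P at *
  generalize ∑ t, x t i = X at *
  rw [le_div_iff₀ hk2]
  have hεk : ε * k ^ 2 ≤ 1 := by rwa [le_div_iff₀ hk2] at hε
  have hTp : (0 : ℝ) < T := by linarith
  have hεT : T * ε * k ^ 2 ≤ T := by nlinarith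
  -- bound T ε k and T ε
  have hTe1 : T * ε * k ≤ T / 2 := by
    by_cases h0 : ε ≤ 0
    · have : T * ε * k ≤ 0 := mul_nonpos_of_nonpos_of_nonneg
        (mul_nonpos_of_nonneg_of_nonpos hTp.le h0) hk.le
      linarith
    · push Not at h0
      have : 0 < T * ε * k := by positivity
      nlinarith
  have hTe2 : T * ε ≤ T / 4 := by
    by_cases h0 : ε ≤ 0
    · have : T * ε ≤ 0 := mul_nonpos_of_nonneg_of_nonpos hTp.le h0
      linarith
    · push Not at h0
      have : 0 < T * ε := by positivity
      nlinarith
  have h3 : k / 2 * P * (2 * k) ≤ (T * ε + 5 / 8 * X) * (2 * k) :=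
    mul_le_mul_of_nonneg_right h1 (by linarith)
  have h4 : x t i * y t i * k ^ 2 ≤ P * k ^ 2 := mul_le_mul_of_nonneg_right hsingle hk2.le
  nlinarith
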